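/- Let B be a basis of V which is equivalent to a basis whose graph is a tree of type D_{m,k} for some m≥2, k≥1. If X⊆B induces a subgraph of Gr(B) isomorphic to a member of the family F, then span(X)∩V₀₀₀ ≠ {0}. -/

import Mathlib

open scoped BigOperators

/-- A `ZMod 2`-valued bilinear form on `V`. -/
abbrev BForm (V : Type*) [AddCommGroup V] [Module (ZMod 2) V] :=
  V →ₗ[ZMod 2] V →ₗ[ZMod 2] ZMod 2

variable {V : Type*} [AddCommGroup V] [Module (ZMod 2) V]

/-- `g` is the transvection `τ_b : x ↦ x + Ω(x,b)·b` for some `b ∈ B`. -/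
def IsTransvection (Ω : BForm V) (B : Set V) (g : V ≃ₗ[ZMod 2] V) : Prop :=
  ∃ b ∈ B, ∀ x : V, g x = x + Ω x b • b

/-- The group `Γ_B` generated by the transvections `τ_b`, `b ∈ B`. -/
def Gamma (Ω : BForm V) (B : Set V) : Subgroup (V ≃ₗ[ZMod 2] V) :=
  Subgroup.closure {g | IsTransvection Ω B g}

/-- `x` and `y` lie in the same `Γ_B`-orbit. -/
def SameOrbit (Ω : BForm V) (B : Set V) (x y : V) : Prop :=
  ∃ g ∈ Gamma Ω B, g x = y

/-- The graph `Gr(X)` on vertex set `X`, with `b, b'` adjacent iff `Ω(b,b') = 1` or `Ω(b',b) = 1`. -/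
def Gr (Ω : BForm V) (X : Set V) : SimpleGraph X :=
  SimpleGraph.fromRel fun a b => Ω a.1 b.1 = 1

/-- One basic move: `B' = φ_{c,a}(B)`, replacing `c` by `c + a`. -/
def MoveRel (Ω : BForm V) (B B' : Set V) : Prop :=
  ∃ a c, a ∈ B ∧ c ∈ B ∧ a ≠ c ∧ Ω a c = 1 ∧ B' = insert (c + a) (B \ {c})

/-- `B` and `B'` are equivalent: related by a finite sequence of basic moves. -/
def EquivSets (Ω : BForm V) : Set V → Set V → Prop :=
  Relation.ReflTransGen (MoveRel Ω)

/-- The kernel `V₀` of the form `Ω`. -/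
def V0set (Ω : BForm V) : Set V := {x | ∀ v : V, Ω x v = 0}

/-- `Δ`, the `Γ_B`-orbit containing `B` (when `Gr(B)` is connected). -/
def Delta (Ω : BForm V) (B : Set V) : Set V :=
  {x | ∃ b ∈ B, SameOrbit Ω B b x}

/-- `V₀₀₀`: vectors of `V₀` of the form `x₁ + x₂` with `x₁, x₂ ∈ Δ`. -/
def V000set (Ω : BForm V) (B : Set V) : Set V :=
  {y | y ∈ V0set Ω ∧ ∃ x₁ ∈ Delta Ω B, ∃ x₂ ∈ Delta Ω B, y = x₁ + x₂}

/-- `U₀₀₀` for `U = span(B)`: vectors of `U₀` of the form `x₁ + x₂` with `x₁, x₂ ∈ Δ`. -/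
def U000set (Ω : BForm V) (B : Set V) : Set V :=
  {y | y ∈ Submodule.span (ZMod 2) B ∧ (∀ u ∈ Submodule.span (ZMod 2) B, Ω y u = 0) ∧
    ∃ x₁ ∈ Delta Ω B, ∃ x₂ ∈ Delta Ω B, y = x₁ + x₂}

/-- `x = x₁ + ⋯ + x_s` with all `x_i ∈ Δ` and `Ω(x_i, x_j) = 0`: a `Δ`-decomposition. -/
def HasDeltaDecomp (Ω : BForm V) (B : Set V) (x : V) (s : ℕ) : Prop :=
  1 ≤ s ∧ ∃ f : Fin s → V, (∀ i, f i ∈ Delta Ω B) ∧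
    (∀ i j, i ≠ j → Ω (f i) (f j) = 0) ∧ x = ∑ i, f i

/-- `d(x)`: minimal length of a `Δ`-decomposition of `x`. -/
noncomputable def dval (Ω : BForm V) (B : Set V) (x : V) : ℕ :=
  sInf {s | HasDeltaDecomp Ω B x s}

/-- `Q` is the quadratic form associated with `Ω` and `S` (`Q(b)=1` on `S`, polarization `Ω`). -/
def IsQuadForm (Ω : BForm V) (S : Set V) (Q : V → ZMod 2) : Prop :=
  (∀ b ∈ S, Q b = 1) ∧ ∀ u v : V, Q (u + v) = Q u + Q v + Ω u v

/-- The tree of type `D_{m,k}`: path `a₁ — ⋯ — a_m` with leaves `c₁, …, c_k` attached to `a_m`. -/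
def DmkGraph (m k : ℕ) : SimpleGraph (Fin m ⊕ Fin k) :=
  SimpleGraph.fromRel fun x y =>
    match x, y with
    | Sum.inl i, Sum.inl j => i.val + 1 = j.val
    | Sum.inl i, Sum.inr _ => i.val + 1 = m
    | _, _ => False

/-- The Dynkin tree `E₆`. -/
def E6Graph : SimpleGraph (Fin 6) :=
  SimpleGraph.fromRel fun i j => (i.val, j.val) ∈ [(0,1),(1,2),(2,3),(3,4),(2,5)]

/-- Two triangles sharing a common edge: four vertices, five edges. -/
def TwoTrianglesGraph : SimpleGraph (Fin 4) :=
  SimpleGraph.fromRel fun i j => (i.val, j.val) ∈ [(0,1),(0,2),(0,3),(1,2),(1,3)]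

/-- The cycle of length `n`. -/
def CycleGraph (n : ℕ) : SimpleGraph (Fin n) :=
  SimpleGraph.fromRel fun i j => j.val = (i.val + 1) % n

/-- Membership in the family `F`: type `D_{2,2}`, two triangles sharing an edge,
or a cycle of length at least `4`. -/
def InF {α : Type*} (G : SimpleGraph α) : Prop :=
  Nonempty (G ≃g DmkGraph 2 2) ∨ Nonempty (G ≃g TwoTrianglesGraph) ∨
    ∃ n, 4 ≤ n ∧ Nonempty (G ≃g CycleGraph n)

/-- `B` is equivalent to a set whose graph is a tree of type `D_{m,k}`. -/
def EquivToDmkTree (Ω : BForm V) (B : Set V) (m k : ℕ) : Prop :=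
  ∃ B' : Set V, EquivSets Ω B B' ∧ Nonempty (Gr Ω B' ≃g DmkGraph m k)

/-- `X` is equivalent to a set whose graph is `E₆`. -/
def EquivToE6 (Ω : BForm V) (X : Set V) : Prop :=
  ∃ X' : Set V, EquivSets Ω X X' ∧ Nonempty (Gr Ω X' ≃g E6Graph)

/-- Some subset of `B` is equivalent to a set whose graph is `E₆`. -/
def HasE6Subgraph (Ω : BForm V) (B : Set V) : Prop :=
  ∃ X ⊆ B, EquivToE6 Ω X

/-- `B` is a basis of `V` (as a set). -/
def IsBasisSet (B : Set V) : Prop :=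
  LinearIndependent (ZMod 2) (Subtype.val : B → V) ∧ Submodule.span (ZMod 2) B = ⊤

/-- `B` is equivalent to a set whose graph is a tree containing `E₆` as an induced subgraph. -/
def EquivToE6Tree (Ω : BForm V) (B : Set V) : Prop :=
  ∃ B' : Set V, EquivSets Ω B B' ∧ (Gr Ω B').IsTree ∧
    ∃ X ⊆ B', Nonempty (Gr Ω X ≃g E6Graph)

/-- `A` is a maximal complete subgraph (maximal clique) of `G`. -/
def IsMaxClique {α : Type*} (G : SimpleGraph α) (A : Set α) : Prop :=
  G.IsClique A ∧ ∀ A', G.IsClique A' → A ⊆ A' → A' = A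

/-! ### Edge vectors: sums of two distinct standard basis vectors over `ZMod 2` -/

/-- `v` is the indicator vector of a two-element subset of `ι`. -/
def IsEdgeVector {ι : Type*} [DecidableEq ι] (v : ι → ZMod 2) : Prop :=
  ∃ p q, p ≠ q ∧ v = Pi.single p 1 + Pi.single q 1

section EdgeVector

theorem zmod_two_pi_add_self {ι : Type*} (v : ι → ZMod 2) : v + v = 0 := by
  funext i; exact CharTwo.add_self_eq_zero _

variable {ι : Type*} [DecidableEq ι] {u v w : ι → ZMod 2} {p q r : ι}

theorem edge_apply_eq_one_iff (hpq : p ≠ q) :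
    (Pi.single p 1 + Pi.single q 1 : ι → ZMod 2) r = 1 ↔ r = p ∨ r = q := by
  simp only [Pi.add_apply, Pi.single_apply]
  split_ifs with h₁ h₂ h₂
  · exact absurd (h₁.symm.trans h₂) hpq
  all_goals simp_all

namespace IsEdgeVector

theorem eq_of_apply (hv : IsEdgeVector v) (hpq : p ≠ q) (hp : v p = 1) (hq : v q = 1) :
    v = Pi.single p 1 + Pi.single q 1 := by
  obtain ⟨a, b, hab, rfl⟩ := hv
  rw [edge_apply_eq_one_iff hab] at hp hq
  rcases hp with rfl | rfl <;> rcases hq with rfl | rfl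
  · exact absurd rfl hpq
  · rfl
  · exact add_comm _ _
  · exact absurd rfl hpq

/-- Among three points of an edge two coincide. -/
theorem pigeonhole (hv : IsEdgeVector v) (hp : v p = 1) (hq : v q = 1) (hr : v r = 1) :
    p = q ∨ p = r ∨ q = r := by
  obtain ⟨a, b, hab, rfl⟩ := hv
  rw [edge_apply_eq_one_iff hab] at hp hq hr
  grind

variable [Fintype ι]

theorem dotProduct_self (hv : IsEdgeVector v) : v ⬝ᵥ v = 0 := by
  obtain ⟨a, b, hab, rfl⟩ := hv
  simp [hab, hab.symm, CharTwo.add_self_eq_zero]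

theorem exists_common (hu : IsEdgeVector u) (h : u ⬝ᵥ v = 1) :
    ∃ p, u p = 1 ∧ v p = 1 := by
  by_contra! hne
  obtain ⟨a, b, hab, rfl⟩ := hu
  have h0 : ∀ x : ZMod 2, x ≠ 1 → x = 0 := by decide
  have ha := h0 _ (hne a ((edge_apply_eq_one_iff hab).2 (Or.inl rfl)))
  have hb := h0 _ (hne b ((edge_apply_eq_one_iff hab).2 (Or.inr rfl)))
  simp [ha, hb] at h

theorem eq_of_common (hu : IsEdgeVector u) (hv : IsEdgeVector v) (h : u ⬝ᵥ v = 0)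
    (hup : u p = 1) (hvp : v p = 1) : u = v := by
  obtain ⟨a, b, hab, rfl⟩ := hu
  simp only [add_dotProduct, single_dotProduct, one_mul] at h
  have h1 : ∀ x y : ZMod 2, x + y = 0 → x = 1 ∨ y = 1 → x = 1 ∧ y = 1 := by decide
  have hp := (edge_apply_eq_one_iff hab).1 hup
  have := h1 _ _ h (by rcases hp with rfl | rfl <;> simp [hvp])
  exact (hv.eq_of_apply hab this.1 this.2).symm

theorem add (hu : IsEdgeVector u) (hv : IsEdgeVector v) (h : u ⬝ᵥ v = 1) :
    IsEdgeVector (u + v) := by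
  obtain ⟨p, hup, hvp⟩ := hu.exists_common h
  have key : ∀ {w : ι → ZMod 2}, IsEdgeVector w → w p = 1 →
      ∃ q, p ≠ q ∧ w = Pi.single p 1 + Pi.single q 1 := by
    rintro w ⟨a, b, hab, rfl⟩ hw
    rcases (edge_apply_eq_one_iff hab).1 hw with rfl | rfl
    · exact ⟨b, hab, rfl⟩
    · exact ⟨a, hab.symm, add_comm _ _⟩
  obtain ⟨q, hpq, rfl⟩ := key hu hup
  obtain ⟨r, hpr, rfl⟩ := key hv hvp
  refine ⟨q, r, ?_, ?_⟩
  · rintro rfl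
    rw [IsEdgeVector.dotProduct_self ⟨p, q, hpq, rfl⟩] at h
    exact zero_ne_one h
  · rw [add_add_add_comm, zmod_two_pi_add_self, zero_add]

/-- If three pairwise orthogonal edges all meet a fourth one in a point,
two of them coincide. -/
theorem exists_eq_of_claw {g : Fin 3 → ι → ZMod 2} (hw : IsEdgeVector w)
    (hg : ∀ i, IsEdgeVector (g i)) (hadj : ∀ i, w ⬝ᵥ g i = 1)
    (hort : ∀ i j, i ≠ j → g i ⬝ᵥ g j = 0) : ∃ i j, i ≠ j ∧ g i = g j := by
  choose p hwp hgp using fun i => hw.exists_common (hadj i)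
  have key : ∀ i j, i ≠ j → p i = p j → g i = g j := fun i j hij hp =>
    (hg i).eq_of_common (hg j) (hort i j hij) (hgp i) (hp ▸ hgp j)
  rcases hw.pigeonhole (hwp 0) (hwp 1) (hwp 2) with h | h | h
  · exact ⟨0, 1, by decide, key _ _ (by decide) h⟩
  · exact ⟨0, 2, by decide, key _ _ (by decide) h⟩
  · exact ⟨1, 2, by decide, key _ _ (by decide) h⟩

/-- Two triangles of edges with a common side: either the opposite edges coincide, or
one of the triangles sums to zero. -/
theorem eq_or_add_eq_of_two_triangles {x y : ι → ZMod 2} (hu : IsEdgeVector u)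
    (hv : IsEdgeVector v) (hx : IsEdgeVector x) (hy : IsEdgeVector y) (huv : u ⬝ᵥ v = 1)
    (hux : u ⬝ᵥ x = 1) (huy : u ⬝ᵥ y = 1) (hvx : v ⬝ᵥ x = 1) (hvy : v ⬝ᵥ y = 1)
    (hxy : x ⬝ᵥ y = 0) : x = y ∨ u + v = x ∨ u + v = y := by
  refine or_iff_not_imp_left.2 fun hne => ?_
  have hdis : ∀ a b, x a = 1 → y b = 1 → a ≠ b := by
    rintro a b ha hb rfl
    exact hne (hx.eq_of_common hy hxy ha hb)
  obtain ⟨p, hup, hxp⟩ := hu.exists_common hux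
  obtain ⟨q, huq, hyq⟩ := hu.exists_common huy
  obtain ⟨p', hvp, hxp'⟩ := hv.exists_common hvx
  obtain ⟨q', hvq, hyq'⟩ := hv.exists_common hvy
  have eu := hu.eq_of_apply (hdis _ _ hxp hyq) hup huq
  have ev := hv.eq_of_apply (hdis _ _ hxp' hyq') hvp hvq
  by_cases hpp : p = p'
  · subst hpp
    by_cases hqq : q = q'
    · subst hqq
      rw [eu, ← ev, hv.dotProduct_self] at huv
      exact absurd huv zero_ne_one
    · right
      rw [hy.eq_of_apply hqq hyq hyq', eu, ev, add_add_add_comm, zmod_two_pi_add_self, zero_add]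
  · by_cases hqq : q = q'
    · subst hqq
      left
      rw [hx.eq_of_apply hpp hxp hxp', eu, ev, add_add_add_comm, zmod_two_pi_add_self, add_zero]
    · have h₁ := hdis _ _ hxp hyq'
      have h₂ := hdis _ _ hxp' hyq
      rw [eu, ev] at huv
      simp [hpp, hqq, h₁, h₂] at huv

/-- A cyclic sequence of edges in which consecutive edges meet in one point and edges at
distance two are disjoint sums to zero. -/
theorem sum_eq_zero_of_cycle {n : ℕ} [NeZero n] {g : Fin n → ι → ZMod 2}
    (hg : ∀ i, IsEdgeVector (g i)) (hadj : ∀ i, g i ⬝ᵥ g (i + 1) = 1)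
    (hort : ∀ i, g i ⬝ᵥ g (i + 1 + 1) = 0) (hne : ∀ i, g i ≠ g (i + 1 + 1)) :
    ∑ i, g i = 0 := by
  choose p hp hp' using fun i => (hg i).exists_common (hadj i)
  have hpp : ∀ i, p i ≠ p (i + 1) := fun i h =>
    hne i ((hg i).eq_of_common (hg _) (hort i) (hp i) (h ▸ hp' (i + 1)))
  have hedge : ∀ i, g (i + 1) = Pi.single (p i) 1 + Pi.single (p (i + 1)) 1 := fun i =>
    (hg _).eq_of_apply (hpp i) (hp' i) (hp _)
  rw [← Equiv.sum_comp (Equiv.addRight 1) g]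
  simp only [Equiv.coe_addRight, hedge, Finset.sum_add_distrib]
  have hshift : ∑ i, (Pi.single (p (i + 1)) 1 : ι → ZMod 2) = ∑ i, Pi.single (p i) 1 :=
    Equiv.sum_comp (Equiv.addRight (1 : Fin n)) fun i => (Pi.single (p i) 1 : ι → ZMod 2)
  rw [hshift, zmod_two_pi_add_self]

end IsEdgeVector

end EdgeVector

/-! ### Graphs, transvections and basic moves -/

section Moves

variable {Ω : BForm V} {B B' : Set V}

theorem alternating_comm (hΩ : ∀ x : V, Ω x x = 0) (x y : V) : Ω x y = Ω y x := by
  have h := hΩ (x + y)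
  simp only [map_add, LinearMap.add_apply, hΩ, zero_add, add_zero] at h
  exact (CharTwo.add_eq_zero.1 h).symm

theorem module_zmod_two_add_self (x : V) : x + x = 0 := by
  rw [← two_smul (ZMod 2) x, show (2 : ZMod 2) = 0 from rfl, zero_smul]

theorem Gr_adj_iff (hΩ : ∀ x : V, Ω x x = 0) {X : Set V} (x y : X) :
    (Gr Ω X).Adj x y ↔ Ω (x : V) (y : V) = 1 := by
  simp only [Gr, SimpleGraph.fromRel_adj]
  rw [alternating_comm hΩ (y : V) (x : V), or_self]
  refine ⟨fun h => h.2, fun h => ⟨?_, h⟩⟩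
  rintro rfl
  rw [hΩ] at h
  exact zero_ne_one h

theorem form_iso_symm_eq_one_iff (hΩ : ∀ x : V, Ω x x = 0) {X : Set V} {α : Type*}
    {G : SimpleGraph α} (e : Gr Ω X ≃g G) (i j : α) :
    Ω (e.symm i : V) (e.symm j : V) = 1 ↔ G.Adj i j := by
  rw [← Gr_adj_iff hΩ, e.symm.map_adj_iff]

theorem form_iso_symm_eq_zero (hΩ : ∀ x : V, Ω x x = 0) {X : Set V} {α : Type*}
    {G : SimpleGraph α} (e : Gr Ω X ≃g G) {i j : α} (h : ¬ G.Adj i j) :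
    Ω (e.symm i : V) (e.symm j : V) = 0 := by
  have h0 : ∀ x : ZMod 2, x ≠ 1 → x = 0 := by decide
  exact h0 _ fun h1 => h ((form_iso_symm_eq_one_iff hΩ e i j).1 h1)

theorem exists_transvection_mem_Gamma (hΩ : ∀ x : V, Ω x x = 0) {b : V} (hb : b ∈ B) :
    ∃ g ∈ Gamma Ω B, ∀ x, g x = x + Ω x b • b :=
  ⟨LinearEquiv.transvection (f := Ω.flip b) (v := b) (hΩ b),
    Subgroup.subset_closure ⟨b, hb, fun _ => rfl⟩, fun _ => rfl⟩

theorem subset_Delta : B ⊆ Delta Ω B := fun b hb => ⟨b, hb, 1, one_mem _, rfl⟩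

theorem apply_mem_Delta {g : V ≃ₗ[ZMod 2] V} (hg : g ∈ Gamma Ω B) {x : V}
    (hx : x ∈ Delta Ω B) : g x ∈ Delta Ω B := by
  obtain ⟨b, hb, g', hg', rfl⟩ := hx
  exact ⟨b, hb, g * g', mul_mem hg hg', rfl⟩

theorem add_mem_Delta (hΩ : ∀ x : V, Ω x x = 0) {x b : V} (hx : x ∈ Delta Ω B) (hb : b ∈ B)
    (h : Ω x b = 1) : x + b ∈ Delta Ω B := by
  obtain ⟨g, hg, hgx⟩ := exists_transvection_mem_Gamma hΩ hb
  have := apply_mem_Delta hg hx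
  rwa [hgx, h, one_smul] at this

theorem MoveRel.Gamma_le (hΩ : ∀ x : V, Ω x x = 0) (h : MoveRel Ω B B') :
    Gamma Ω B' ≤ Gamma Ω B := by
  obtain ⟨a, c, ha, hc, -, hac, rfl⟩ := h
  refine (Subgroup.closure_le _).2 ?_
  rintro g ⟨b, hb, hg⟩
  rcases hb with rfl | hb
  · obtain ⟨s, hs, hsx⟩ := exists_transvection_mem_Gamma hΩ ha
    obtain ⟨t, ht, htx⟩ := exists_transvection_mem_Gamma hΩ hc
    have : g = s * t * s := by
      ext x
      have hca : Ω c a = 1 := (alternating_comm hΩ c a).trans hac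
      have h01 : ∀ y : ZMod 2, y = 0 ∨ y = 1 := by decide
      have haa := module_zmod_two_add_self a
      have hcc := module_zmod_two_add_self c
      simp only [LinearEquiv.mul_apply, hg, hsx, htx, map_add, map_smul, LinearMap.add_apply,
        LinearMap.smul_apply, hΩ, hac, hca, smul_eq_mul, mul_one]
      rcases h01 (Ω x a) with h₁ | h₁ <;> rcases h01 (Ω x c) with h₂ | h₂ <;>
        simp [h₁, h₂, CharTwo.add_self_eq_zero] <;> grind
    rw [this]
    exact mul_mem (mul_mem hs ht) hs
  · exact Subgroup.subset_closure ⟨b, hb.1, hg⟩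

theorem MoveRel.Delta_subset (hΩ : ∀ x : V, Ω x x = 0) (h : MoveRel Ω B B') :
    Delta Ω B' ⊆ Delta Ω B := by
  rintro x ⟨b, hb, g, hg, rfl⟩
  refine apply_mem_Delta (h.Gamma_le hΩ hg) ?_
  obtain ⟨a, c, ha, hc, -, hac, rfl⟩ := h
  rcases hb with rfl | hb
  · exact add_mem_Delta hΩ (subset_Delta hc) ha ((alternating_comm hΩ c a).trans hac)
  · exact subset_Delta hb.1

theorem EquivSets.Delta_subset (hΩ : ∀ x : V, Ω x x = 0) (h : EquivSets Ω B B') :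
    Delta Ω B' ⊆ Delta Ω B := by
  induction h with
  | refl => exact subset_rfl
  | tail _ hmove ih => exact (hmove.Delta_subset hΩ).trans ih

theorem MoveRel.isBasisSet (h : MoveRel Ω B B') (hB : IsBasisSet B) : IsBasisSet B' := by
  obtain ⟨a, c, ha, hc, hne, -, rfl⟩ := h
  have ha' : a ∈ Submodule.span (ZMod 2) (B \ {c}) := Submodule.subset_span ⟨ha, hne⟩
  have hsum : c = c + a + a := by rw [add_assoc, module_zmod_two_add_self, add_zero]
  constructor
  · have hlin : LinearIndepOn (ZMod 2) id B := hB.1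
    refine (hlin.mono Set.sdiff_subset).id_insert fun hmem => ?_
    have hcs := add_mem hmem ha'
    rw [← hsum] at hcs
    rw [← Set.insert_sdiff_self_of_mem hc, linearIndepOn_id_insert (by simp)] at hlin
    exact hlin.2 hcs
  · rw [eq_top_iff, ← hB.2, Submodule.span_le]
    intro x hx
    by_cases hxc : x = c
    · have := add_mem (Submodule.subset_span (Set.mem_insert _ _))
        (Submodule.span_mono (Set.subset_insert (c + a) _) ha')
      rw [← hsum] at this
      rwa [hxc]
    · exact Submodule.subset_span (Set.mem_insert_of_mem _ ⟨hx, hxc⟩)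

theorem EquivSets.isBasisSet (h : EquivSets Ω B B') (hB : IsBasisSet B) : IsBasisSet B' := by
  induction h with
  | refl => exact hB
  | tail _ hmove ih => exact hmove.isBasisSet ih

/-- If a linear map realizes `Ω` as a dot product and sends the members of `B'` to edge vectors,
it does the same for every set equivalent to `B'`. -/
theorem EquivSets.isEdgeVector {ι : Type*} [DecidableEq ι] [Fintype ι]
    {π : V →ₗ[ZMod 2] ι → ZMod 2}
    (hΩ : ∀ x : V, Ω x x = 0) (hπ : ∀ x y, Ω x y = π x ⬝ᵥ π y) (h : EquivSets Ω B B')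
    (hB' : ∀ b ∈ B', IsEdgeVector (π b)) : ∀ b ∈ B, IsEdgeVector (π b) := by
  induction h using Relation.ReflTransGen.head_induction_on with
  | refl => exact hB'
  | head hmove _ ih =>
    obtain ⟨a, c, ha, hc, hne, hac, rfl⟩ := hmove
    intro b hb
    by_cases hbc : b = c
    · have h₁ := ih _ (Set.mem_insert _ _)
      have h₂ := ih a (Set.mem_insert_of_mem _ ⟨ha, hne⟩)
      have hsum : b = c + a + a := by rw [hbc, add_assoc, module_zmod_two_add_self, add_zero]
      rw [hsum, map_add]
      refine h₁.add h₂ ?_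
      rw [← hπ, map_add, LinearMap.add_apply, hΩ, add_zero, alternating_comm hΩ, hac]
    · exact ih b (Set.mem_insert_of_mem _ ⟨hb, hbc⟩)

end Moves

/-! ### The edge representation of a tree of type `D_{m,k}` -/

section DmkTree

/-- The edge vector of a vertex of the tree of type `D_{m,k}`: `a_i` is sent to the edge
joining `i` and `i + 1`, and all `c_j` to the edge joining `m` and `m + 1`. -/
def dmkEdge (m k : ℕ) : Fin m ⊕ Fin k → Fin (m + 2) → ZMod 2
  | Sum.inl i => Pi.single i.castSucc.castSucc 1 + Pi.single i.succ.castSucc 1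
  | Sum.inr _ => Pi.single (Fin.last m).castSucc 1 + Pi.single (Fin.last (m + 1)) 1

variable {m k : ℕ}

theorem isEdgeVector_dmkEdge (s : Fin m ⊕ Fin k) : IsEdgeVector (dmkEdge m k s) := by
  rcases s with i | j
  · exact ⟨_, _, by simp [Fin.ext_iff], rfl⟩
  · exact ⟨_, _, by simp [Fin.ext_iff], rfl⟩

theorem dmkEdge_dotProduct (s t : Fin m ⊕ Fin k) [Decidable ((DmkGraph m k).Adj s t)] :
    dmkEdge m k s ⬝ᵥ dmkEdge m k t = if (DmkGraph m k).Adj s t then 1 else 0 := by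
  rcases s with i | i <;> rcases t with j | j <;>
    simp only [dmkEdge, add_dotProduct, single_dotProduct, one_mul, Pi.add_apply,
      Pi.single_apply, DmkGraph, SimpleGraph.fromRel_adj, Fin.ext_iff, Fin.val_castSucc,
      Fin.val_succ, Fin.val_last, ne_eq, Sum.inl.injEq, reduceCtorEq, not_false_eq_true,
      true_and, or_self, or_false, false_or, and_false, if_false, Sum.inr.injEq] <;>
    have := i.2 <;> have := j.2 <;> split_ifs <;> first | omega | decide

/-- A combination of the tree edges vanishes only if the path coefficients vanish. -/
theorem coeff_inl_eq_zero_of_sum_dmkEdge (γ : Fin m ⊕ Fin k → ZMod 2)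
    (h : ∑ s, γ s • dmkEdge m k s = 0) (i : Fin m) : γ (Sum.inl i) = 0 := by
  set P : Fin (m + 2) → ZMod 2 := fun p => if p.val ≤ i.val then 1 else 0
  have hl : ∀ j, dmkEdge m k (Sum.inl j) ⬝ᵥ P = if j = i then 1 else 0 := by
    intro j
    simp only [dmkEdge, add_dotProduct, single_dotProduct, one_mul, P, Fin.val_castSucc,
      Fin.val_succ, Fin.ext_iff]
    split_ifs <;> first | omega | decide
  have hr : ∀ j, dmkEdge m k (Sum.inr j) ⬝ᵥ P = 0 := by
    intro j
    have := i.2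
    simp only [dmkEdge, add_dotProduct, single_dotProduct, one_mul, P, Fin.val_castSucc,
      Fin.val_last]
    split_ifs <;> first | omega | decide
  have h0 := congrArg (· ⬝ᵥ P) h
  simpa [sum_dotProduct, smul_dotProduct, hl, hr] using h0

variable {Ω : BForm V} {B : Set V}

/-- Adding to a vector of `Δ` members of `B` which are mutually orthogonal and not orthogonal
to it stays in `Δ`. -/
theorem add_sum_mem_Delta (hΩ : ∀ x : V, Ω x x = 0) {α : Type*} {x : V}
    {f : α → V} (hx : x ∈ Delta Ω B) (hf : ∀ i, f i ∈ B) (hxf : ∀ i, Ω x (f i) = 1)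
    (hff : ∀ i j, Ω (f i) (f j) = 0) (S : Finset α) : x + ∑ i ∈ S, f i ∈ Delta Ω B := by
  classical
  induction S using Finset.induction_on with
  | empty => simpa using hx
  | insert j S hj ih =>
    rw [Finset.sum_insert hj, add_left_comm, add_comm]
    refine add_mem_Delta hΩ ih (hf j) ?_
    simp [hxf, hff]

/-- A basis equivalent to a tree of type `D_{m,k}` is represented by edges on `m + 2` points, and
the kernel of the representation lies in `V₀₀₀`. -/
theorem exists_edge_representation (hΩ : ∀ x : V, Ω x x = 0) (hB : IsBasisSet B) (hm : 1 ≤ m)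
    (hequiv : EquivToDmkTree Ω B m k) :
    ∃ π : V →ₗ[ZMod 2] Fin (m + 2) → ZMod 2, (∀ x y, Ω x y = π x ⬝ᵥ π y) ∧
      (∀ b ∈ B, IsEdgeVector (π b)) ∧ ∀ y, π y = 0 → y ∈ V000set Ω B := by
  classical
  obtain ⟨B', hBB', ⟨e⟩⟩ := hequiv
  have hB' := hBB'.isBasisSet hB
  let b : Module.Basis (Fin m ⊕ Fin k) (ZMod 2) V :=
    (Module.Basis.mk hB'.1 (by simp [hB'.2])).reindex e.toEquiv
  have hb : ∀ s, b s = (e.symm s : V) := fun s => by simp [b]; rfl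
  have hbmem : ∀ s, b s ∈ B' := fun s => hb s ▸ (e.symm s).2
  let π : V →ₗ[ZMod 2] Fin (m + 2) → ZMod 2 := b.constr (ZMod 2) (dmkEdge m k)
  have hπb : ∀ s, π (b s) = dmkEdge m k s := fun s => b.constr_basis _ _ s
  have hΩb : ∀ s t, Ω (b s) (b t) = dmkEdge m k s ⬝ᵥ dmkEdge m k t := by
    intro s t
    rw [dmkEdge_dotProduct, hb, hb]
    split_ifs with h
    · exact (form_iso_symm_eq_one_iff hΩ e s t).2 h
    · exact form_iso_symm_eq_zero hΩ e h
  have hπ : ∀ x y, Ω x y = π x ⬝ᵥ π y := by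
    have : Ω = (dotProductBilin (ZMod 2) (ZMod 2)).compl₁₂ π π := by
      refine b.ext fun s => b.ext fun t => ?_
      simp [hΩb, hπb, dotProductBilin]
    intro x y
    rw [this]
    rfl
  refine ⟨π, hπ, hBB'.isEdgeVector hΩ hπ fun x hx => ?_, fun y hy => ⟨fun v => ?_, ?_⟩⟩
  · have : x = b (e ⟨x, hx⟩) := by rw [hb]; simp
    rw [this, hπb]
    exact isEdgeVector_dmkEdge _
  · rw [hπ, hy, zero_dotProduct]
  · have hcoeff : ∀ i, b.repr y (Sum.inl i) = 0 := by
      refine coeff_inl_eq_zero_of_sum_dmkEdge _ ?_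
      rw [← hy]
      conv_rhs => rw [← b.sum_repr y]
      simp only [map_sum, map_smul, hπb]
    have hysum : y = ∑ j with b.repr y (Sum.inr j) = 1, b (Sum.inr j) := by
      conv_lhs => rw [← b.sum_repr y]
      rw [Fintype.sum_sum_type, Finset.sum_filter]
      simp only [hcoeff, zero_smul, Finset.sum_const_zero, zero_add]
      refine Finset.sum_congr rfl fun j _ => ?_
      have h01 : ∀ x : ZMod 2, x ≠ 1 → x = 0 := by decide
      split_ifs with h
      · rw [h, one_smul]
      · rw [h01 _ h, zero_smul]
    have hx := subset_Delta (Ω := Ω) (hbmem (Sum.inl ⟨m - 1, by omega⟩))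
    refine ⟨_, hBB'.Delta_subset hΩ hx, _, hBB'.Delta_subset hΩ
      (add_sum_mem_Delta hΩ hx (fun j => hbmem (Sum.inr j)) (fun j => ?_) (fun i j => ?_)
        {j | b.repr y (Sum.inr j) = 1}), ?_⟩
    · rw [hΩb, dmkEdge_dotProduct, if_pos]
      simp only [DmkGraph, SimpleGraph.fromRel_adj]
      exact ⟨by simp, Or.inl (Nat.sub_add_cancel hm)⟩
    · rw [hΩb, dmkEdge_dotProduct, if_neg]
      simp [DmkGraph]
    · rw [← hysum, ← add_assoc, module_zmod_two_add_self, zero_add]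

end DmkTree

/-! ### Members of the family `F` -/

section Family

variable {ι : Type*} [Fintype ι] [DecidableEq ι]

/-- If the members of `X` are represented by edges and their graph belongs to `F`,
then some nonempty set of them has sum in the kernel of the representation. -/
theorem exists_sum_eq_zero_of_inF {Ω : BForm V} (hΩ : ∀ x : V, Ω x x = 0)
    {π : V →ₗ[ZMod 2] ι → ZMod 2} (hπ : ∀ x y, Ω x y = π x ⬝ᵥ π y) {X : Set V}
    (hX : ∀ x ∈ X, IsEdgeVector (π x)) (hXF : InF (Gr Ω X)) :
    ∃ S : Finset X, S.Nonempty ∧ ∑ x ∈ S, π x = 0 := by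
  classical
  have of_eq : ∀ {x y : X}, x ≠ y → π x = π y →
      ∃ S : Finset X, S.Nonempty ∧ ∑ x ∈ S, π x = 0 := fun {x y} hxy h =>
    ⟨{x, y}, by simp, by rw [Finset.sum_pair hxy, h, zmod_two_pi_add_self]⟩
  have of_add : ∀ {x y z : X}, x ≠ y → x ≠ z → y ≠ z → π x + π y = π z →
      ∃ S : Finset X, S.Nonempty ∧ ∑ x ∈ S, π x = 0 := fun {x y z} hxy hxz hyz h =>
    ⟨{x, y, z}, by simp, by
      rw [Finset.sum_insert (by simp [hxy, hxz]), Finset.sum_pair hyz, ← add_assoc, h,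
        zmod_two_pi_add_self]⟩
  have hedge : ∀ x : X, IsEdgeVector (π x) := fun x => hX x x.2
  rcases hXF with ⟨⟨e⟩⟩ | ⟨⟨e⟩⟩ | ⟨n, hn, ⟨e⟩⟩
  · let v : Fin 3 → Fin 2 ⊕ Fin 2 := ![Sum.inl 0, Sum.inr 0, Sum.inr 1]
    have hv : Function.Injective v := by decide
    obtain ⟨i, j, hij, h⟩ := IsEdgeVector.exists_eq_of_claw (g := fun i => π (e.symm (v i)))
      (hedge (e.symm (Sum.inl 1))) (fun i => hedge _)
      (fun i => by
        rw [← hπ, form_iso_symm_eq_one_iff hΩ e]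
        fin_cases i <;> simp [v, DmkGraph])
      (fun i j hij => by
        rw [← hπ]
        refine form_iso_symm_eq_zero hΩ e ?_
        fin_cases i <;> fin_cases j <;> simp [v, DmkGraph])
    exact of_eq (fun hx => hij (hv (e.symm.injective hx))) h
  · have hadj : ∀ i j, TwoTrianglesGraph.Adj i j → π (e.symm i) ⬝ᵥ π (e.symm j) = 1 :=
      fun i j h => by rw [← hπ, form_iso_symm_eq_one_iff hΩ e]; exact h
    have hort : π (e.symm 2) ⬝ᵥ π (e.symm 3) = 0 := by
      rw [← hπ]
      exact form_iso_symm_eq_zero hΩ e (by simp [TwoTrianglesGraph])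
    have hne : ∀ {i j : Fin 4}, i ≠ j → e.symm i ≠ e.symm j := fun h h' =>
      h (e.symm.injective h')
    rcases IsEdgeVector.eq_or_add_eq_of_two_triangles (hedge (e.symm 0)) (hedge (e.symm 1))
      (hedge (e.symm 2)) (hedge (e.symm 3)) (hadj 0 1 (by simp [TwoTrianglesGraph]))
      (hadj 0 2 (by simp [TwoTrianglesGraph])) (hadj 0 3 (by simp [TwoTrianglesGraph]))
      (hadj 1 2 (by simp [TwoTrianglesGraph])) (hadj 1 3 (by simp [TwoTrianglesGraph]))
      hort with h | h | h
    · exact of_eq (hne (by decide)) h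
    · exact of_add (hne (by decide)) (hne (by decide)) (hne (by decide)) h
    · exact of_add (hne (by decide)) (hne (by decide)) (hne (by decide)) h
  · obtain ⟨n, rfl⟩ := Nat.exists_eq_add_of_le' hn
    have hval : ∀ i : Fin (n + 4), (i + 1).val = (i.val + 1) % (n + 4) := fun i => by
      simp [Fin.val_add]
    have hcases : ∀ i : Fin (n + 4), i.val + 1 < n + 4 ∧ (i + 1).val = i.val + 1 ∨
        i.val + 1 = n + 4 ∧ (i + 1).val = 0 := fun i => by
      rw [hval]
      rcases Nat.lt_or_ge (i.val + 1) (n + 4) with h | h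
      · exact Or.inl ⟨h, Nat.mod_eq_of_lt h⟩
      · have h' : i.val + 1 = n + 4 := by omega
        exact Or.inr ⟨h', by rw [h', Nat.mod_self]⟩
    have hne₁ : ∀ i : Fin (n + 4), i ≠ i + 1 := fun i h => by
      have := congrArg Fin.val h
      grind
    have hne₂ : ∀ i : Fin (n + 4), i ≠ i + 1 + 1 := fun i h => by
      have := congrArg Fin.val h
      grind
    have hne₃ : ∀ i : Fin (n + 4), i ≠ i + 1 + 1 + 1 := fun i h => by
      have := congrArg Fin.val h
      grind
    by_cases hinj : ∃ i, π (e.symm i) = π (e.symm (i + 1 + 1))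
    · obtain ⟨i, hi⟩ := hinj
      exact of_eq (fun h => hne₂ i (e.symm.injective h)) hi
    · push Not at hinj
      refine ⟨Finset.univ.map e.symm.toEquiv.toEmbedding, by simp, ?_⟩
      rw [Finset.sum_map]
      refine IsEdgeVector.sum_eq_zero_of_cycle (g := fun i => π (e.symm i)) (fun i => hedge _)
        (fun i => ?_) (fun i => ?_) hinj
      · rw [← hπ, form_iso_symm_eq_one_iff hΩ e]
        simp only [CycleGraph, SimpleGraph.fromRel_adj]
        exact ⟨hne₁ i, Or.inl (hval i)⟩
      · rw [← hπ]
        refine form_iso_symm_eq_zero hΩ e fun h => ?_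
        simp only [CycleGraph, SimpleGraph.fromRel_adj, ← hval, Fin.val_inj] at h
        rcases h with ⟨-, h | h⟩
        · exact hne₁ (i + 1) h.symm
        · exact hne₃ i h

end Family

/-- Let `B` be a basis equivalent to a basis whose graph is a tree of type
`D_{m,k}` (`m ≥ 2`, `k ≥ 1`). If `X ⊆ B` induces a subgraph of `Gr(B)` isomorphic to a
member of `F`, then `span(X) ∩ V₀₀₀ ≠ {0}`. -/
theorem stmt_5 {V : Type*} [AddCommGroup V] [Module (ZMod 2) V]
    [FiniteDimensional (ZMod 2) V]
    (Ω : BForm V) (hΩ : ∀ x : V, Ω x x = 0)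
    (B : Set V) (hB : IsBasisSet B)
    (m k : ℕ) (hm : 2 ≤ m) (hk : 1 ≤ k) (hequiv : EquivToDmkTree Ω B m k)
    (X : Set V) (hX : X ⊆ B) (hXF : InF (Gr Ω X)) :
    ∃ y ∈ (Submodule.span (ZMod 2) X : Set V) ∩ V000set Ω B, y ≠ 0 := by
  obtain ⟨π, hπ, hedge, hker⟩ := exists_edge_representation hΩ hB (by omega) hequiv
  obtain ⟨S, hS, hsum⟩ := exists_sum_eq_zero_of_inF hΩ hπ (fun x hx => hedge x (hX hx)) hXF
  refine ⟨∑ x ∈ S, (x : V), ⟨sum_mem fun x _ => Submodule.subset_span x.2,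
    hker _ (by rw [map_sum, hsum])⟩, fun h0 => ?_⟩
  have hlin : LinearIndependent (ZMod 2) (Subtype.val : X → V) :=
    LinearIndepOn.mono (v := id) hB.1 hX
  obtain ⟨x, hx⟩ := hS
  have := linearIndependent_iff'.1 hlin S (fun _ => 1) (by simpa using h0) x hx
  exact one_ne_zero this
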